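/- Under the standing assumptions, there exist k ∈ ℕ_{≥1}, c ∈ (0,1), r ∈ (0,1), and C > 0 such that for every g ∈ SL(2,ℝ): ∫ sys(hg)^{−c} dμ^{*k}(h) ≤ r · sys(g)^{−c} + C. -/

import Mathlib

open MeasureTheory Filter Topology

abbrev SL2 := Matrix.SpecialLinearGroup (Fin 2) ℝ

noncomputable instance : TopologicalSpace SL2 :=
  (instTopologicalSpaceSubtype : TopologicalSpace {A : Matrix (Fin 2) (Fin 2) ℝ // A.det = 1})

noncomputable instance : MeasurableSpace SL2 := borel SL2

/-- The group of orientation-preserving affine maps of ℝ, modeled as pairs `(r, b)`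
with `r > 0`, acting by `t ↦ r * t + b`. -/
abbrev AffP : Type := {p : ℝ × ℝ // 0 < p.1}

/-- The topological support of a measure. -/
def msupport {α : Type*} [TopologicalSpace α] [MeasurableSpace α] (μ : Measure α) : Set α :=
  {x | ∀ U : Set α, IsOpen U → x ∈ U → 0 < μ U}

/-- The element of `P ⊂ SL(2,ℝ)` corresponding to the affine map `t ↦ r t + b`, namely
`a(r)⁻¹ u(b) = [[r^{-1/2}, r^{-1/2} b], [0, r^{1/2}]]`. -/
noncomputable def toP (φ : AffP) : SL2 :=
  ⟨!![(Real.sqrt φ.1.1)⁻¹, (Real.sqrt φ.1.1)⁻¹ * φ.1.2; 0, Real.sqrt φ.1.1], by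
    have h : Real.sqrt φ.1.1 ≠ 0 := ne_of_gt (Real.sqrt_pos.mpr φ.2)
    simp [Matrix.det_fin_two_of, inv_mul_cancel₀ h]⟩

/-- `convN μ n` is the `n`-fold convolution power `μ^{*n}`, i.e. the law of a product of
`n` i.i.d. `μ`-distributed matrices. -/
noncomputable def convN (μ : Measure SL2) : ℕ → Measure SL2
  | 0 => Measure.dirac 1
  | n + 1 => Measure.map (fun p : SL2 × SL2 => p.1 * p.2) (μ.prod (convN μ n))

/-- The Euclidean norm on ℝ². -/
noncomputable def enorm2 (w : Fin 2 → ℝ) : ℝ := Real.sqrt (w 0 ^ 2 + w 1 ^ 2)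

/-- The systole of `g ∈ SL(2,ℝ)`: the minimum of `‖g v‖` over nonzero `v ∈ ℤ²`. -/
noncomputable def sys (g : SL2) : ℝ :=
  sInf {x : ℝ | ∃ v : Fin 2 → ℤ, v ≠ 0 ∧
    x = enorm2 ((g : Matrix (Fin 2) (Fin 2) ℝ).mulVec (fun i => (v i : ℝ)))}

/-- The action of an affine map on the real line. -/
def AffP.act (φ : AffP) (x : ℝ) : ℝ := φ.1.1 * x + φ.1.2

lemma AffP.measurable_act : Measurable fun p : AffP × ℝ => p.1.act p.2 := by
  unfold AffP.act
  fun_prop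

/-- Prepend a term to a sequence. -/
def seqCons {α : Type*} (a : α) (ω : ℕ → α) : ℕ → α
  | 0 => a
  | n + 1 => ω n

lemma measurable_seqCons {α : Type*} [MeasurableSpace α] :
    Measurable fun p : α × (ℕ → α) => seqCons p.1 p.2 := by
  refine measurable_pi_iff.2 fun n => ?_
  cases n with
  | zero => exact measurable_fst
  | succ n => exact (measurable_pi_apply n).comp measurable_snd

lemma map_seqCons_infinitePi {α : Type*} [MeasurableSpace α] (μ : Measure α)
    [IsProbabilityMeasure μ] :
    Measure.map (fun p : α × (ℕ → α) => seqCons p.1 p.2)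
      (μ.prod (Measure.infinitePi fun _ : ℕ => μ)) = Measure.infinitePi fun _ : ℕ => μ := by
  classical
  refine Measure.eq_infinitePi _ fun s t ht => ?_
  set t' : ℕ → Set α := fun i => if i ∈ s then t i else Set.univ with ht'
  have hmt' : ∀ i, MeasurableSet (t' i) := fun i => by
    simp only [ht']
    split_ifs
    exacts [ht i, MeasurableSet.univ]
  obtain ⟨N, hN⟩ : ∃ N, s ⊆ Finset.range (N + 1) :=
    ⟨s.sup id, fun i hi => by
      simpa [Nat.lt_succ_iff] using Finset.le_sup (f := id) hi⟩
  have hpi : (s : Set ℕ).pi t = (Finset.range (N + 1) : Set ℕ).pi t' := by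
    ext x
    simp only [Set.mem_pi, ht', Finset.mem_coe]
    refine ⟨fun h i _ => ?_, fun h i hi => ?_⟩
    · split_ifs with hi
      exacts [h i hi, trivial]
    · simpa [hi] using h i (hN hi)
  have hprod : ∏ i ∈ s, μ (t i) = ∏ i ∈ Finset.range (N + 1), μ (t' i) := by
    rw [← Finset.prod_subset hN]
    · exact Finset.prod_congr rfl fun i hi => by simp [ht', hi]
    · intro i _ hi
      simp [ht', hi]
  have hpre : (fun p : α × (ℕ → α) => seqCons p.1 p.2) ⁻¹' (Finset.range (N + 1) : Set ℕ).pi t'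
      = t' 0 ×ˢ (Finset.range N : Set ℕ).pi fun i => t' (i + 1) := by
    ext ⟨a, ω⟩
    simp only [Set.mem_preimage, Set.mem_pi, Set.mem_prod, Finset.coe_range, Set.mem_Iio]
    refine ⟨fun h => ⟨h 0 (by omega), fun i hi => h (i + 1) (by omega)⟩, fun h i hi => ?_⟩
    cases i with
    | zero => exact h.1
    | succ i => exact h.2 i (by omega)
  rw [hpi, hprod, Measure.map_apply measurable_seqCons
    (MeasurableSet.pi (Finset.countable_toSet _) fun i _ => hmt' i), hpre, Measure.prod_prod,
    Measure.infinitePi_pi _ fun i _ => hmt' (i + 1), Finset.prod_range_succ', mul_comm]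

/-- The `j`-th term of the perpetuity series `∑ⱼ r₀ ⋯ rⱼ₋₁ bⱼ`. -/
noncomputable def perpTerm (ω : ℕ → AffP) (j : ℕ) : ℝ :=
  (∏ i ∈ Finset.range j, (ω i).1.1) * (ω j).1.2

lemma measurable_perpTerm (j : ℕ) : Measurable fun ω : ℕ → AffP => perpTerm ω j := by
  unfold perpTerm
  fun_prop

lemma perpTerm_seqCons_succ (φ : AffP) (ω : ℕ → AffP) (j : ℕ) :
    perpTerm (seqCons φ ω) (j + 1) = φ.1.1 * perpTerm ω j := by
  simp only [perpTerm, Finset.prod_range_succ', seqCons]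
  ring

lemma lintegral_perpTerm_rpow (lam : Measure AffP) [IsProbabilityMeasure lam] {u : ℝ}
    (j : ℕ) :
    ∫⁻ ω, ENNReal.ofReal (|perpTerm ω j| ^ u) ∂(Measure.infinitePi fun _ : ℕ => lam) =
      (∫⁻ φ, ENNReal.ofReal (φ.1.1 ^ u) ∂lam) ^ j * ∫⁻ φ, ENNReal.ofReal (|φ.1.2| ^ u) ∂lam := by
  have hm : ∀ j, Measurable fun ω : ℕ → AffP => ENNReal.ofReal (|perpTerm ω j| ^ u) := fun j =>
    (((measurable_perpTerm j).abs).pow_const u).ennreal_ofReal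
  induction j with
  | zero =>
    rw [← map_seqCons_infinitePi, lintegral_map (hm 0) measurable_seqCons]
    have : ∀ p : AffP × (ℕ → AffP), ENNReal.ofReal (|perpTerm (seqCons p.1 p.2) 0| ^ u)
        = ENNReal.ofReal (|p.1.1.2| ^ u) * 1 := fun p => by simp [perpTerm, seqCons]
    simp_rw [this]
    rw [lintegral_prod_mul (f := fun φ : AffP => ENNReal.ofReal (|φ.1.2| ^ u))
      (g := fun _ => 1) (by fun_prop) (by fun_prop)]
    simp
  | succ j ih =>
    rw [← map_seqCons_infinitePi, lintegral_map (hm (j + 1)) measurable_seqCons]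
    have : ∀ p : AffP × (ℕ → AffP), ENNReal.ofReal (|perpTerm (seqCons p.1 p.2) (j + 1)| ^ u)
        = ENNReal.ofReal (p.1.1.1 ^ u) * ENNReal.ofReal (|perpTerm p.2 j| ^ u) := fun p => by
      rw [perpTerm_seqCons_succ, abs_mul, abs_of_pos p.1.2,
        Real.mul_rpow p.1.2.le (abs_nonneg _), ENNReal.ofReal_mul (Real.rpow_nonneg p.1.2.le _)]
    simp_rw [this]
    rw [lintegral_prod_mul (f := fun φ : AffP => ENNReal.ofReal (φ.1.1 ^ u)) (by fun_prop)
      (hm j).aemeasurable, ih, pow_succ']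
    ring

lemma ae_summable_perpTerm (lam : Measure AffP) [IsProbabilityMeasure lam] {u : ℝ}
    (hu : 0 < u) (hu1 : u ≤ 1) (hr : ∫⁻ φ : AffP, ENNReal.ofReal (φ.1.1 ^ u) ∂lam < 1)
    (hb : ∫⁻ φ : AffP, ENNReal.ofReal (|φ.1.2| ^ u) ∂lam < ⊤) :
    ∀ᵐ ω ∂(Measure.infinitePi fun _ : ℕ => lam), Summable (perpTerm ω) := by
  have hm : ∀ j, Measurable fun ω : ℕ → AffP => ENNReal.ofReal (|perpTerm ω j| ^ u) := fun j =>
    (((measurable_perpTerm j).abs).pow_const u).ennreal_ofReal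
  have hfin : ∫⁻ ω, ∑' j, ENNReal.ofReal (|perpTerm ω j| ^ u)
      ∂(Measure.infinitePi fun _ : ℕ => lam) ≠ ⊤ := by
    rw [lintegral_tsum fun j => (hm j).aemeasurable]
    simp_rw [lintegral_perpTerm_rpow]
    rw [ENNReal.tsum_mul_right, ENNReal.tsum_geometric]
    refine ENNReal.mul_ne_top (ENNReal.inv_ne_top.2 ?_) hb.ne
    exact (tsub_pos_of_lt hr).ne'
  filter_upwards [ae_lt_top (Measurable.tsum hm) hfin] with ω hω
  have hs : Summable fun j => |perpTerm ω j| ^ u := by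
    have := ENNReal.summable_toReal hω.ne
    refine this.congr fun j => ?_
    rw [ENNReal.toReal_ofReal (Real.rpow_nonneg (abs_nonneg _) _)]
  refine hs.of_norm_bounded_eventually_nat ?_
  have h0 := hs.tendsto_atTop_zero.eventually (gt_mem_nhds (zero_lt_one' ℝ))
  filter_upwards [h0] with j hj
  have h1 : |perpTerm ω j| ≤ 1 := by
    by_contra! h
    exact absurd (Real.one_le_rpow h.le hu.le) (not_le.2 hj)
  rw [Real.norm_eq_abs]
  rcases (abs_nonneg (perpTerm ω j)).eq_or_lt with h | h
  · rw [← h, Real.zero_rpow hu.ne']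
  · simpa using Real.rpow_le_rpow_of_exponent_ge h h1 hu1

/-- A contracting-on-average random affine walk has a stationary probability measure. -/
lemma exists_stationary (lam : Measure AffP) [IsProbabilityMeasure lam] {u : ℝ}
    (hu : 0 < u) (hu1 : u ≤ 1) (hr : ∫⁻ φ : AffP, ENNReal.ofReal (φ.1.1 ^ u) ∂lam < 1)
    (hb : ∫⁻ φ : AffP, ENNReal.ofReal (|φ.1.2| ^ u) ∂lam < ⊤) :
    ∃ ν : Measure ℝ, IsProbabilityMeasure ν ∧
      Measure.map (fun p : AffP × ℝ => p.1.act p.2) (lam.prod ν) = ν := by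
  set P := Measure.infinitePi fun _ : ℕ => lam with hP
  set X : (ℕ → AffP) → ℝ := fun ω => ∑' j, perpTerm ω j with hX
  have hXm : Measurable X := Measurable.tsum measurable_perpTerm
  refine ⟨Measure.map X P, Measure.isProbabilityMeasure_map hXm.aemeasurable, ?_⟩
  have h1 : lam.prod (Measure.map X P) = Measure.map (Prod.map id X) (lam.prod P) := by
    rw [← Measure.map_prod_map _ _ measurable_id hXm, Measure.map_id]
  rw [h1, Measure.map_map AffP.measurable_act (measurable_id.prodMap hXm)]
  conv_rhs => rw [hP, ← map_seqCons_infinitePi, Measure.map_map hXm measurable_seqCons]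
  refine Measure.map_congr ?_
  have hs : ∀ᵐ p ∂(lam.prod P), Summable (perpTerm p.2) :=
    Measure.quasiMeasurePreserving_snd.ae (ae_summable_perpTerm lam hu hu1 hr hb)
  filter_upwards [hs] with p hp
  have h2 : Summable (perpTerm (seqCons p.1 p.2)) := by
    rw [← summable_nat_add_iff 1]
    simp_rw [perpTerm_seqCons_succ]
    exact hp.mul_left _
  simp only [Function.comp, Prod.map, id, hX]
  rw [h2.tsum_eq_zero_add]
  simp_rw [perpTerm_seqCons_succ]
  rw [tsum_mul_left]
  simp [AffP.act, perpTerm, seqCons, add_comm]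

lemma exists_small_exponent (lam : Measure AffP) [IsProbabilityMeasure lam] {ε : ℝ} (hε : 0 < ε)
    (hp : Integrable (fun φ : AffP => φ.1.1 ^ ε) lam)
    (hn : Integrable (fun φ : AffP => φ.1.1 ^ (-ε)) lam)
    (hcontr : ∫ φ : AffP, Real.log φ.1.1 ∂lam < 0) {u₀ : ℝ} (hu₀ : 0 < u₀) :
    ∃ u, 0 < u ∧ u < u₀ ∧ u < ε ∧ ∫⁻ φ : AffP, ENNReal.ofReal (φ.1.1 ^ u) ∂lam < 1 := by
  set X : AffP → ℝ := fun φ => Real.log φ.1.1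
  have hexp : ∀ (t : ℝ) (φ : AffP), Real.exp (t * X φ) = φ.1.1 ^ t := fun t φ => by
    rw [Real.rpow_def_of_pos φ.2, mul_comm]
  have hint : Set.Icc (-ε) ε ⊆ ProbabilityTheory.integrableExpSet X lam := by
    refine (ProbabilityTheory.convex_integrableExpSet).ordConnected.out ?_ ?_
    · simpa [ProbabilityTheory.integrableExpSet, hexp] using hn
    · simpa [ProbabilityTheory.integrableExpSet, hexp] using hp
  have h0 : (0 : ℝ) ∈ interior (ProbabilityTheory.integrableExpSet X lam) :=
    interior_mono hint (by rw [interior_Icc]; exact ⟨by linarith, hε⟩)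
  have hd := ProbabilityTheory.hasDerivAt_mgf h0
  simp only [zero_mul, Real.exp_zero, mul_one] at hd
  have hev : ∀ᶠ t in 𝓝[>] (0 : ℝ), ProbabilityTheory.mgf X lam t < 1 := by
    have h1 := (hasDerivAt_iff_tendsto_slope.1 hd).eventually (gt_mem_nhds hcontr)
    have h2 := h1.filter_mono (nhdsWithin_mono (0 : ℝ) fun t (ht : 0 < t) => ht.ne')
    filter_upwards [h2, self_mem_nhdsWithin] with t ht (ht0 : 0 < t)
    rw [slope_def_field, ProbabilityTheory.mgf_zero, sub_zero, div_neg_iff] at ht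
    rcases ht with h | h
    · exact absurd h.2 (not_lt.2 ht0.le)
    · linarith [h.1]
  obtain ⟨u, hu1, hu⟩ := (hev.and (Ioo_mem_nhdsGT (lt_min hu₀ hε))).exists
  refine ⟨u, hu.1, hu.2.trans_le (min_le_left _ _), hu.2.trans_le (min_le_right _ _), ?_⟩
  have hi : Integrable (fun φ : AffP => φ.1.1 ^ u) lam := by
    have := hint (⟨by linarith [hu.1], (hu.2.trans_le (min_le_right _ _)).le⟩ : u ∈ Set.Icc (-ε) ε)
    simpa [ProbabilityTheory.integrableExpSet, hexp] using this
  rw [← ofReal_integral_eq_lintegral_ofReal hi (ae_of_all _ fun φ => Real.rpow_nonneg φ.2.le _)]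
  rw [ENNReal.ofReal_lt_one]
  simpa [ProbabilityTheory.mgf, hexp] using hu1

lemma msupport_ae {α : Type*} [TopologicalSpace α] [MeasurableSpace α] {μ : Measure α}
    {p : α → Prop} (hp : IsClosed {x | p x}) (h : ∀ᵐ x ∂μ, p x) : ∀ x ∈ msupport μ, p x := by
  intro x hx
  by_contra hn
  exact (hx _ hp.isOpen_compl hn).ne' h

/-- A stationary measure of an affine walk without global fixed point has no atoms. -/
lemma stationary_noAtoms (lam : Measure AffP) [IsProbabilityMeasure lam]
    (hnofix : ¬ ∃ t : ℝ, ∀ φ ∈ msupport lam, φ.1.1 * t + φ.1.2 = t)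
    (ν : Measure ℝ) [IsProbabilityMeasure ν]
    (hν : Measure.map (fun p : AffP × ℝ => p.1.act p.2) (lam.prod ν) = ν) (x : ℝ) :
    ν {x} = 0 := by
  by_contra hx
  have hx0 : 0 < ν {x} := pos_iff_ne_zero.2 hx
  have hfin : ∀ m : ENNReal, 0 < m → {y : ℝ | m ≤ ν {y}}.Finite := fun m hm =>
    Measure.finite_const_le_meas_of_disjoint_iUnion ν hm (fun y => measurableSet_singleton y)
      (fun y z hyz => Set.disjoint_singleton.2 hyz) (measure_ne_top _ _)
  obtain ⟨y₀, hy₀, hmax⟩ := Set.exists_max_image {y : ℝ | ν {x} ≤ ν {y}} (fun y => ν {y})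
    (hfin _ hx0) ⟨x, le_refl (ν {x})⟩
  set m := ν {y₀} with hm
  have hm0 : 0 < m := hx0.trans_le hy₀
  have hle : ∀ y, ν {y} ≤ m := fun y => by
    rcases le_total (ν {x}) (ν {y}) with h | h
    · exact hmax y h
    · exact h.trans hy₀
  set F : Set ℝ := {y | m ≤ ν {y}} with hF
  have hFfin : F.Finite := hfin m hm0
  have hinvm : ∀ y : ℝ, Measurable fun φ : AffP => (y - φ.1.2) / φ.1.1 := fun y => by fun_prop
  have hsm : ∀ y : ℝ, ∀ᵐ φ ∂lam, y ∈ F → (y - φ.1.2) / φ.1.1 ∈ F := by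
    intro y
    by_cases hyF : y ∈ F
    swap
    · exact ae_of_all _ fun φ h => absurd h hyF
    have hpre : ∀ φ : AffP, Prod.mk φ ⁻¹' ((fun p : AffP × ℝ => p.1.act p.2) ⁻¹' {y})
        = {(y - φ.1.2) / φ.1.1} := fun φ => by
      ext z
      have := φ.2.ne'
      simp only [Set.mem_preimage, Set.mem_singleton_iff, AffP.act]
      rw [eq_div_iff this]
      constructor <;> intro h <;> linarith
    have hnm : Measurable fun φ : AffP => ν {(y - φ.1.2) / φ.1.1} := by
      have := measurable_measure_prodMk_left (ν := ν)
        (AffP.measurable_act (measurableSet_singleton y))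
      simpa only [hpre] using this
    have hint : ∫⁻ φ, ν {(y - φ.1.2) / φ.1.1} ∂lam = m := by
      have h1 : ν {y} = m := le_antisymm (hle y) hyF
      rw [← h1]
      conv_rhs => rw [← hν, Measure.map_apply AffP.measurable_act (measurableSet_singleton y),
        Measure.prod_apply (AffP.measurable_act (measurableSet_singleton y))]
      simp_rw [hpre]
    have hae : (fun φ : AffP => ν {(y - φ.1.2) / φ.1.1}) =ᵐ[lam] fun _ => m := by
      refine ae_eq_of_ae_le_of_lintegral_le (ae_of_all _ fun φ => hle _) ?_ aemeasurable_const ?_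
      · rw [hint]; exact measure_ne_top _ _
      · rw [hint]; simp
    filter_upwards [hae] with φ hφ _
    exact hφ.ge
  have hall : ∀ᵐ φ ∂lam, ∀ y ∈ F, (y - φ.1.2) / φ.1.1 ∈ F :=
    (ae_ball_iff hFfin.countable).2 fun y hy => (hsm y).mono fun φ h => h hy
  obtain ⟨t, htF, htmax⟩ := Set.exists_max_image F id hFfin ⟨y₀, le_refl m⟩
  refine hnofix ⟨t, ?_⟩
  refine msupport_ae ?_ ?_
  · exact isClosed_eq (by fun_prop) continuous_const
  · filter_upwards [hall] with φ hφ
    have hpos := φ.2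
    have hinj : Set.InjOn (fun y : ℝ => (y - φ.1.2) / φ.1.1) F := by
      intro a _ b _ hab
      simp only at hab
      rw [div_left_inj' hpos.ne'] at hab
      linarith
    have himage : (fun y : ℝ => (y - φ.1.2) / φ.1.1) '' F = F :=
      Set.eq_of_subset_of_ncard_le (Set.image_subset_iff.2 hφ)
        hinj.ncard_image.ge hFfin
    obtain ⟨y, hyF, hy⟩ := himage.ge htF
    have h1 : y ≤ t := htmax y hyF
    have h2 : (t - φ.1.2) / φ.1.1 ≤ t := htmax _ (hφ t htF)
    have h3 : (y - φ.1.2) / φ.1.1 = t := hy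
    rw [div_le_iff₀ hpos] at h2
    rw [div_eq_iff hpos.ne'] at h3
    linarith

lemma exists_measure_abs_gt_le (ν : Measure ℝ) [IsProbabilityMeasure ν] {η : ENNReal}
    (hη : 0 < η) : ∃ M : ℝ, 0 < M ∧ ν {ξ | M < |ξ|} ≤ η := by
  have ht : Tendsto (fun n : ℕ => ν {ξ : ℝ | (n : ℝ) < |ξ|}) atTop (𝓝 0) := by
    have h := tendsto_measure_iInter_atTop (μ := ν) (s := fun n : ℕ => {ξ : ℝ | (n : ℝ) < |ξ|})
      (fun n => (measurableSet_lt measurable_const measurable_id.abs).nullMeasurableSet)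
      (fun a b hab ξ (hξ : (b : ℝ) < |ξ|) => (Nat.cast_le.2 hab).trans_lt hξ)
      ⟨0, measure_ne_top _ _⟩
    have he : ⋂ n : ℕ, {ξ : ℝ | (n : ℝ) < |ξ|} = ∅ := by
      ext ξ
      obtain ⟨n, hn⟩ := exists_nat_gt |ξ|
      simp only [Set.mem_iInter, Set.mem_ofPred_eq, Set.mem_empty_iff_false, iff_false, not_forall]
      exact ⟨n, not_lt.2 hn.le⟩
    rwa [he, measure_empty] at h
  obtain ⟨n, hn, hn1⟩ := ((ht.eventually (gt_mem_nhds hη)).and (eventually_ge_atTop 1)).exists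
  exact ⟨n, by exact_mod_cast hn1, hn.le⟩

lemma exists_ball_measure_le (ν : Measure ℝ) [IsProbabilityMeasure ν] (hν : ∀ x, ν {x} = 0)
    {η : ENNReal} (hη : 0 < η) (M : ℝ) :
    ∃ δ : ℝ, 0 < δ ∧ ∀ x, |x| ≤ M → ν (Metric.ball x δ) ≤ η := by
  have hloc : ∀ x : ℝ, ∃ ρ : ℝ, 0 < ρ ∧ ν (Metric.ball x ρ) ≤ η := by
    intro x
    obtain ⟨U, hxU, hU, hUη⟩ := Set.exists_isOpen_lt_of_lt {x} η (by rw [hν x]; exact hη)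
    obtain ⟨ρ, hρ, hρU⟩ := Metric.isOpen_iff.1 hU x (hxU rfl)
    exact ⟨ρ, hρ, (measure_mono hρU).trans hUη.le⟩
  choose ρ hρ hρη using hloc
  obtain ⟨δ, hδ, h⟩ := lebesgue_number_lemma_of_metric (isCompact_closedBall (0 : ℝ) M)
    (c := fun x : ℝ => Metric.ball x (ρ x)) (fun x => Metric.isOpen_ball)
    (fun x _ => Set.mem_iUnion.2 ⟨x, Metric.mem_ball_self (hρ x)⟩)
  refine ⟨δ, hδ, fun x hx => ?_⟩
  obtain ⟨y, hy⟩ := h x (by simpa [Real.norm_eq_abs] using hx)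
  exact (measure_mono hy).trans (hρη y)

/-- Uniform non-concentration of an atomless measure near the zero of a linear form. -/
lemma exists_linear_nonconcentration (ν : Measure ℝ) [IsProbabilityMeasure ν]
    (hν : ∀ x, ν {x} = 0) {η : ENNReal} (hη : 0 < η) :
    ∃ δ : ℝ, 0 < δ ∧ ∀ X Y : ℝ, ν {ξ | |X + ξ * Y| < δ * (|X| + |Y|)} ≤ η := by
  have hη2 : 0 < η / 2 := ENNReal.half_pos hη.ne'
  obtain ⟨M, hM, hMη⟩ := exists_measure_abs_gt_le ν hη2
  obtain ⟨ρ, hρ, hball⟩ := exists_ball_measure_le ν hν hη2 (2 * M + 1)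
  set δ := min (1 / 2) (ρ / (2 * (M + 1))) with hδ
  have hδ0 : 0 < δ := lt_min (by norm_num) (by positivity)
  have hδ1 : δ ≤ 1 / 2 := min_le_left _ _
  have hδ2 : 2 * (M + 1) * δ ≤ ρ := by
    have := min_le_right (1 / 2) (ρ / (2 * (M + 1)))
    rw [← hδ, le_div_iff₀ (by positivity)] at this
    linarith
  refine ⟨δ, hδ0, fun X Y => ?_⟩
  by_cases hY : |X| + |Y| ≤ 2 * (M + 1) * |Y|
  · rcases eq_or_ne Y 0 with hY0 | hY0
    · have hX0 : |X| ≤ 0 := by simpa [hY0] using hY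
      have hX0' : X = 0 := by simpa using hX0
      simp [hX0', hY0]
    have hYp : 0 < |Y| := abs_pos.2 hY0
    have hxb : |-(X / Y)| ≤ 2 * M + 1 := by
      rw [abs_neg, abs_div, div_le_iff₀ hYp]
      linarith
    refine (measure_mono ?_).trans ((hball _ hxb).trans ENNReal.half_le_self)
    intro ξ (hξ : |X + ξ * Y| < δ * (|X| + |Y|))
    rw [Metric.mem_ball, Real.dist_eq]
    have h1 : X + ξ * Y = (ξ - -(X / Y)) * Y := by field_simp; ring
    rw [h1, abs_mul] at hξ
    have h2 : |ξ - -(X / Y)| * |Y| < ρ * |Y| := by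
      refine hξ.trans_le ?_
      calc δ * (|X| + |Y|) ≤ δ * (2 * (M + 1) * |Y|) := by gcongr
        _ = (2 * (M + 1) * δ) * |Y| := by ring
        _ ≤ ρ * |Y| := by gcongr
    exact lt_of_mul_lt_mul_right h2 hYp.le
  · push Not at hY
    refine (measure_mono ?_).trans (hMη.trans ENNReal.half_le_self)
    intro ξ (hξ : |X + ξ * Y| < δ * (|X| + |Y|))
    by_contra hξM
    have hξM' : |ξ| ≤ M := not_lt.1 hξM
    have h1 : |X| - |ξ * Y| ≤ |X + ξ * Y| := by
      have := abs_sub_abs_le_abs_sub X (-(ξ * Y))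
      rwa [abs_neg, sub_neg_eq_add] at this
    have h2 : |ξ * Y| ≤ M * |Y| := by rw [abs_mul]; gcongr
    have h3 : δ * (|X| + |Y|) ≤ 1 / 2 * (|X| + |Y|) := by gcongr
    nlinarith [abs_nonneg X, abs_nonneg Y]

/-- `AffP.comp φ ψ` is the affine map `ψ ∘ φ`, in the order matching `toP φ * toP ψ`. -/
def AffP.comp (φ ψ : AffP) : AffP :=
  ⟨(ψ.1.1 * φ.1.1, ψ.1.1 * φ.1.2 + ψ.1.2), mul_pos ψ.2 φ.2⟩

lemma AffP.act_comp (φ ψ : AffP) (x : ℝ) : (φ.comp ψ).act x = ψ.act (φ.act x) := by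
  simp only [AffP.act, AffP.comp]
  ring

lemma AffP.measurable_comp : Measurable fun p : AffP × AffP => p.1.comp p.2 := by
  unfold AffP.comp
  refine Measurable.subtype_mk ?_
  fun_prop

/-- The identity affine map. -/
def AffP.id : AffP := ⟨(1, 0), one_pos⟩

/-- The law of a composition of `n` independent affine maps of law `lam`. -/
noncomputable def affConv (lam : Measure AffP) : ℕ → Measure AffP
  | 0 => Measure.dirac AffP.id
  | n + 1 => Measure.map (fun p : AffP × AffP => p.1.comp p.2) (lam.prod (affConv lam n))

instance isProbabilityMeasure_affConv (lam : Measure AffP) [IsProbabilityMeasure lam] (n : ℕ) :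
    IsProbabilityMeasure (affConv lam n) := by
  induction n with
  | zero => exact Measure.dirac.isProbabilityMeasure
  | succ n ih => exact Measure.isProbabilityMeasure_map AffP.measurable_comp.aemeasurable

lemma toP_comp (φ ψ : AffP) : toP (φ.comp ψ) = toP φ * toP ψ := by
  have h1 := Real.sqrt_pos.2 φ.2
  have h2 := Real.sqrt_pos.2 ψ.2
  have h3 := Real.mul_self_sqrt ψ.2.le
  have h4 := Real.sqrt_mul ψ.2.le φ.1.1
  apply Subtype.ext
  rw [Matrix.SpecialLinearGroup.coe_mul]
  ext i j
  fin_cases i <;> fin_cases j <;>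
    simp [toP, AffP.comp, h4, Matrix.mul_apply, Fin.sum_univ_two]
  · field_simp
    rw [sq, h3]
    ring
  · ring

lemma continuous_toP : Continuous toP := by
  unfold toP
  refine Continuous.subtype_mk ?_ _
  refine continuous_matrix fun i j => ?_
  have h : ∀ φ : AffP, Real.sqrt φ.1.1 ≠ 0 := fun φ => (Real.sqrt_pos.2 φ.2).ne'
  have h1 : Continuous fun φ : AffP => (Real.sqrt φ.1.1)⁻¹ :=
    Continuous.inv₀ (by fun_prop) h
  fin_cases i <;> fin_cases j <;> simp <;> fun_prop

instance borelSpace_SL2 : BorelSpace SL2 := ⟨rfl⟩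

lemma continuous_SL2_coe : Continuous fun g : SL2 => (g : Matrix (Fin 2) (Fin 2) ℝ) :=
  continuous_subtype_val

instance secondCountableTopology_SL2 : SecondCountableTopology SL2 :=
  haveI : SecondCountableTopology (Matrix (Fin 2) (Fin 2) ℝ) :=
    inferInstanceAs (SecondCountableTopology (Fin 2 → Fin 2 → ℝ))
  Topology.IsEmbedding.secondCountableTopology
    (f := fun g : SL2 => (g : Matrix (Fin 2) (Fin 2) ℝ)) Topology.IsEmbedding.subtypeVal

lemma measurable_toP : Measurable toP := continuous_toP.measurable

lemma measurable_SL2_mul : Measurable fun p : SL2 × SL2 => p.1 * p.2 := by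
  have : Continuous fun p : SL2 × SL2 => p.1 * p.2 := by
    refine Continuous.subtype_mk ?_ _
    exact (continuous_SL2_coe.comp continuous_fst).mul (continuous_SL2_coe.comp continuous_snd)
  exact this.measurable

lemma convN_map_toP (lam : Measure AffP) [IsProbabilityMeasure lam] (n : ℕ) :
    convN (Measure.map toP lam) n = Measure.map toP (affConv lam n) := by
  induction n with
  | zero =>
    rw [convN, affConv, Measure.map_dirac' measurable_toP]
    congr 1
    apply Subtype.ext
    ext i j
    fin_cases i <;> fin_cases j <;> simp [toP, AffP.id]
  | succ n ih =>
    rw [convN, affConv, ih, Measure.map_prod_map _ _ measurable_toP measurable_toP,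
      Measure.map_map measurable_SL2_mul (measurable_toP.prodMap measurable_toP),
      Measure.map_map measurable_toP AffP.measurable_comp]
    congr 1
    funext p
    exact (toP_comp p.1 p.2).symm

lemma lintegral_affConv_act (lam : Measure AffP) [IsProbabilityMeasure lam] (ν : Measure ℝ)
    [IsProbabilityMeasure ν]
    (hν : Measure.map (fun p : AffP × ℝ => p.1.act p.2) (lam.prod ν) = ν) (n : ℕ)
    {f : ℝ → ENNReal} (hf : Measurable f) :
    ∫⁻ p : AffP × ℝ, f (p.1.act p.2) ∂((affConv lam n).prod ν) = ∫⁻ x, f x ∂ν := by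
  induction n with
  | zero =>
    have hm : Measurable fun p : AffP × ℝ => f (p.1.act p.2) := hf.comp AffP.measurable_act
    rw [lintegral_prod _ hm.aemeasurable, affConv, lintegral_dirac' _ hm.lintegral_prod_right']
    simp [AffP.act, AffP.id]
  | succ n ih =>
    have hm : Measurable fun p : AffP × ℝ => f (p.1.act p.2) := hf.comp AffP.measurable_act
    have hg : Measurable fun y : ℝ => ∫⁻ ψ, f (AffP.act ψ y) ∂(affConv lam n) :=
      Measurable.lintegral_prod_left' (f := fun p : AffP × ℝ => f (p.1.act p.2)) hm
    calc ∫⁻ p : AffP × ℝ, f (p.1.act p.2) ∂((affConv lam (n + 1)).prod ν)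
        = ∫⁻ x, ∫⁻ φ, f (AffP.act φ x) ∂(affConv lam (n + 1)) ∂ν :=
          lintegral_prod_symm' _ hm
      _ = ∫⁻ x, ∫⁻ φ, ∫⁻ ψ, f (AffP.act ψ (AffP.act φ x)) ∂(affConv lam n) ∂lam ∂ν := by
          refine lintegral_congr fun x => ?_
          have hx : Measurable fun φ : AffP => f (φ.act x) :=
            hm.comp (measurable_id.prodMk measurable_const)
          have hx' : Measurable fun p : AffP × AffP => f ((p.1.comp p.2).act x) :=
            hx.comp AffP.measurable_comp
          rw [affConv, lintegral_map hx AffP.measurable_comp, lintegral_prod _ hx'.aemeasurable]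
          simp_rw [AffP.act_comp]
      _ = ∫⁻ p : AffP × ℝ, ∫⁻ ψ, f (AffP.act ψ (p.1.act p.2)) ∂(affConv lam n)
            ∂(lam.prod ν) :=
          (lintegral_prod_symm' _ (hg.comp AffP.measurable_act)).symm
      _ = ∫⁻ y, ∫⁻ ψ, f (AffP.act ψ y) ∂(affConv lam n) ∂ν := by
          conv_rhs => rw [← hν, lintegral_map hg AffP.measurable_act]
      _ = ∫⁻ p : AffP × ℝ, f (p.1.act p.2) ∂((affConv lam n).prod ν) :=
          (lintegral_prod_symm' _ hm).symm
      _ = ∫⁻ x, f x ∂ν := ih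

lemma lintegral_affConv_rpow_le (lam : Measure AffP) [IsProbabilityMeasure lam]
    {G : AffP → ENNReal} (hG : Measurable G) (hmul : ∀ φ ψ, G (φ.comp ψ) ≤ G φ * G ψ)
    {a : ℝ} (ha : 0 ≤ a) (n : ℕ) :
    ∫⁻ φ, G φ ^ a ∂(affConv lam n) ≤ (∫⁻ φ, G φ ^ a ∂lam) ^ n * G AffP.id ^ a := by
  have hGa : Measurable fun φ => G φ ^ a := hG.pow_const a
  induction n with
  | zero => rw [affConv, lintegral_dirac' _ hGa]; simp
  | succ n ih =>
    rw [affConv, lintegral_map hGa AffP.measurable_comp]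
    calc ∫⁻ p : AffP × AffP, G (p.1.comp p.2) ^ a ∂(lam.prod (affConv lam n))
        ≤ ∫⁻ p : AffP × AffP, G p.1 ^ a * G p.2 ^ a ∂(lam.prod (affConv lam n)) := by
          refine lintegral_mono fun p => ?_
          rw [← ENNReal.mul_rpow_of_nonneg _ _ ha]
          exact ENNReal.rpow_le_rpow (hmul _ _) ha
      _ = (∫⁻ φ, G φ ^ a ∂lam) * ∫⁻ φ, G φ ^ a ∂(affConv lam n) :=
          lintegral_prod_mul hGa.aemeasurable hGa.aemeasurable
      _ ≤ (∫⁻ φ, G φ ^ a ∂lam) * ((∫⁻ φ, G φ ^ a ∂lam) ^ n * G AffP.id ^ a) := by gcongr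
      _ = _ := by rw [pow_succ', mul_assoc]

lemma lintegral_rpow_inv_pow_le {α : Type*} [MeasurableSpace α] (μ : Measure α)
    [IsProbabilityMeasure μ] {G : α → ENNReal} (hG : Measurable G) {k : ℕ} (hk : 1 ≤ k) :
    (∫⁻ x, G x ^ (k : ℝ)⁻¹ ∂μ) ^ k ≤ ∫⁻ x, G x ∂μ := by
  have hk0 : (0 : ℝ) < k := by exact_mod_cast hk
  have h := eLpNorm'_le_eLpNorm'_of_exponent_le (f := fun x => G x) (inv_pos.2 hk0)
    (inv_le_one_of_one_le₀ (by exact_mod_cast hk : (1 : ℝ) ≤ k)) μ hG.aestronglyMeasurable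
  simpa [eLpNorm'] using h

/-- A submultiplicative function on affine maps has controlled roots along the walk. -/
lemma lintegral_affConv_root_le (lam : Measure AffP) [IsProbabilityMeasure lam]
    {G : AffP → ENNReal} (hG : Measurable G) (hmul : ∀ φ ψ, G (φ.comp ψ) ≤ G φ * G ψ)
    {k : ℕ} (hk : 1 ≤ k) :
    ∫⁻ φ, G φ ^ (k : ℝ)⁻¹ ∂(affConv lam k) ≤ (∫⁻ φ, G φ ∂lam) * G AffP.id ^ (k : ℝ)⁻¹ :=
  (lintegral_affConv_rpow_le lam hG hmul (by positivity) k).trans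
    (by gcongr; exact lintegral_rpow_inv_pow_le lam hG hk)

lemma tendsto_affConv_ratio (lam : Measure AffP) [IsProbabilityMeasure lam] {u : ℝ} (hu : 0 < u)
    (hr : ∫⁻ φ : AffP, ENNReal.ofReal (φ.1.1 ^ u) ∂lam < 1) {t : ℝ} (ht : 0 < t) :
    Tendsto (fun k => affConv lam k {φ | t < φ.1.1}) atTop (𝓝 0) := by
  set A := ∫⁻ φ : AffP, ENNReal.ofReal (φ.1.1 ^ u) ∂lam with hA
  have hm : Measurable fun φ : AffP => ENNReal.ofReal (φ.1.1 ^ u) := by fun_prop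
  have hint : ∀ k, ∫⁻ φ, ENNReal.ofReal (φ.1.1 ^ u) ∂(affConv lam k) ≤ A ^ k := fun k => by
    have h := lintegral_affConv_rpow_le lam hm (fun φ ψ => ?_) zero_le_one k
    · simpa [AffP.id] using h
    · rw [← ENNReal.ofReal_mul (Real.rpow_nonneg φ.2.le _),
        ← Real.mul_rpow φ.2.le ψ.2.le, mul_comm]
      rfl
  have htu : ENNReal.ofReal (t ^ u) ≠ 0 := by
    simpa using Real.rpow_pos_of_pos ht u
  have hbound : ∀ k, affConv lam k {φ | t < φ.1.1} ≤ A ^ k / ENNReal.ofReal (t ^ u) := fun k => by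
    rw [ENNReal.le_div_iff_mul_le (Or.inl htu) (Or.inl ENNReal.ofReal_ne_top), mul_comm]
    refine le_trans ?_ ((mul_meas_ge_le_lintegral hm (ENNReal.ofReal (t ^ u))).trans (hint k))
    refine mul_le_mul' le_rfl (measure_mono fun φ hφ => ?_)
    exact ENNReal.ofReal_le_ofReal (Real.rpow_le_rpow ht.le (le_of_lt hφ) hu.le)
  have hlim : Tendsto (fun k => A ^ k / ENNReal.ofReal (t ^ u)) atTop (𝓝 0) := by
    have := ENNReal.Tendsto.div_const (ENNReal.tendsto_pow_atTop_nhds_zero_of_lt_one hr)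
      (Or.inr htu)
    simpa using this
  exact tendsto_of_tendsto_of_tendsto_of_le_of_le tendsto_const_nhds hlim
    (fun _ => zero_le) hbound

/-- The affine walk rarely sends a linear form close to zero, uniformly in the form. -/
lemma exists_affConv_nonconcentration (lam : Measure AffP) [IsProbabilityMeasure lam]
    (hnofix : ¬ ∃ t : ℝ, ∀ φ ∈ msupport lam, φ.1.1 * t + φ.1.2 = t) {u : ℝ}
    (hu : 0 < u) (hu1 : u ≤ 1) (hr : ∫⁻ φ : AffP, ENNReal.ofReal (φ.1.1 ^ u) ∂lam < 1)
    (hb : ∫⁻ φ : AffP, ENNReal.ofReal (|φ.1.2| ^ u) ∂lam < ⊤) {η : ENNReal} (hη : 0 < η) :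
    ∃ δ : ℝ, 0 < δ ∧ ∀ᶠ k in atTop, ∀ X Y : ℝ,
      affConv lam k {φ | |X + φ.1.2 * Y| < δ * (|X| + |Y|)} ≤ η := by
  obtain ⟨ν, hνp, hν⟩ := exists_stationary lam hu hu1 hr hb
  have hη2 : 0 < η / 2 := ENNReal.half_pos hη.ne'
  have hη4 : 0 < η / 2 / 2 := ENNReal.half_pos hη2.ne'
  obtain ⟨δ, hδ, hlin⟩ :=
    exists_linear_nonconcentration ν (stationary_noAtoms lam hnofix ν hν) hη2
  obtain ⟨M, hM, hMη⟩ := exists_measure_abs_gt_le ν hη4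
  refine ⟨δ / 2, half_pos hδ, ?_⟩
  have hev := (tendsto_affConv_ratio lam hu hr (t := δ / 2 / M) (by positivity)).eventually
    (gt_mem_nhds hη4)
  filter_upwards [hev] with k hk X Y
  set S := {ξ : ℝ | |X + ξ * Y| < δ * (|X| + |Y|)} with hS
  have hSm : MeasurableSet S := measurableSet_lt (by fun_prop) measurable_const
  have hpre : ((affConv lam k).prod ν) {p | p.1.act p.2 ∈ S} = ν S := by
    have h := lintegral_affConv_act lam ν hν k (f := S.indicator 1) (measurable_one.indicator hSm)
    rw [lintegral_indicator_one hSm] at h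
    change ((affConv lam k).prod ν) ((fun p : AffP × ℝ => p.1.act p.2) ⁻¹' S) = _
    rw [← h, ← lintegral_indicator_one (AffP.measurable_act hSm)]
    rfl
  have hsub : {φ : AffP | |X + φ.1.2 * Y| < δ / 2 * (|X| + |Y|)} ×ˢ (Set.univ : Set ℝ) ⊆
      {p | p.1.act p.2 ∈ S} ∪ ({φ : AffP | δ / 2 / M < φ.1.1} ×ˢ (Set.univ : Set ℝ) ∪
        (Set.univ : Set AffP) ×ˢ {ξ : ℝ | M < |ξ|}) := by
    rintro ⟨φ, ξ⟩ ⟨hφ, -⟩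
    by_contra hn
    simp only [Set.mem_union, Set.mem_ofPred_eq, Set.mem_prod, Set.mem_univ, and_true, true_and,
      not_or, not_lt] at hn hφ
    obtain ⟨h1, h2, h3⟩ := hn
    apply h1
    have hpos := φ.2
    have h4 : |φ.1.1 * ξ| ≤ δ / 2 := by
      rw [abs_mul, abs_of_pos hpos]
      calc φ.1.1 * |ξ| ≤ δ / 2 / M * M := by gcongr
        _ = δ / 2 := by field_simp
    change |X + (φ.1.1 * ξ + φ.1.2) * Y| < δ * (|X| + |Y|)
    have h5 : X + (φ.1.1 * ξ + φ.1.2) * Y = (X + φ.1.2 * Y) + (φ.1.1 * ξ) * Y := by ring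
    have h6 : |(φ.1.1 * ξ) * Y| ≤ δ / 2 * |Y| := by rw [abs_mul]; gcongr
    rw [h5]
    refine (abs_add_le _ _).trans_lt ?_
    nlinarith [abs_nonneg X, abs_nonneg Y]
  calc affConv lam k {φ | |X + φ.1.2 * Y| < δ / 2 * (|X| + |Y|)}
      = ((affConv lam k).prod ν)
          ({φ : AffP | |X + φ.1.2 * Y| < δ / 2 * (|X| + |Y|)} ×ˢ (Set.univ : Set ℝ)) := by
        rw [Measure.prod_prod, measure_univ, mul_one]
    _ ≤ ν S + (affConv lam k {φ : AffP | δ / 2 / M < φ.1.1} + ν {ξ : ℝ | M < |ξ|}) := by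
        refine (measure_mono hsub).trans ((measure_union_le _ _).trans ?_)
        rw [hpre]
        gcongr
        refine (measure_union_le _ _).trans_eq ?_
        rw [Measure.prod_prod, Measure.prod_prod, measure_univ, measure_univ, mul_one, one_mul]
    _ ≤ η / 2 + (η / 2 / 2 + η / 2 / 2) := by
        gcongr
        exact hlin X Y
    _ = η := by rw [ENNReal.add_halves, ENNReal.add_halves]

/-- The sum of the absolute values of the entries of a matrix. -/
noncomputable def entrySum (g : SL2) : ℝ := |g 0 0| + |g 0 1| + |g 1 0| + |g 1 1|

lemma SL2_det_eq (g : SL2) : g 0 0 * g 1 1 - g 0 1 * g 1 0 = 1 := by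
  rw [← Matrix.det_fin_two]
  exact g.2

lemma entrySum_mul_le (g h : SL2) : entrySum (g * h) ≤ entrySum g * entrySum h := by
  have hk : ∀ a b c d : ℝ, |a * b + c * d| ≤ |a| * |b| + |c| * |d| := fun a b c d => by
    simpa [abs_mul] using abs_add_le (a * b) (c * d)
  simp only [entrySum, Matrix.SpecialLinearGroup.coe_mul, Matrix.mul_apply, Fin.sum_univ_two]
  have h1 := hk (g 0 0) (h 0 0) (g 0 1) (h 1 0)
  have h2 := hk (g 0 0) (h 0 1) (g 0 1) (h 1 1)
  have h3 := hk (g 1 0) (h 0 0) (g 1 1) (h 1 0)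
  have h4 := hk (g 1 0) (h 0 1) (g 1 1) (h 1 1)
  have := abs_nonneg (g 0 0)
  have := abs_nonneg (g 0 1)
  have := abs_nonneg (g 1 0)
  have := abs_nonneg (g 1 1)
  have := abs_nonneg (h 0 0)
  have := abs_nonneg (h 0 1)
  have := abs_nonneg (h 1 0)
  have := abs_nonneg (h 1 1)
  refine (add_le_add (add_le_add (add_le_add h1 h2) h3) h4).trans ?_
  rw [← sub_nonneg]
  ring_nf
  positivity

lemma one_le_entrySum (g : SL2) : 1 ≤ entrySum g := by
  have hd := SL2_det_eq g
  have h1 : (1 : ℝ) ≤ |g 0 0| * |g 1 1| + |g 0 1| * |g 1 0| := by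
    rw [← abs_mul, ← abs_mul]
    exact hd.ge.trans ((le_abs_self _).trans (abs_sub _ _))
  by_contra! h
  unfold entrySum at h
  nlinarith [abs_nonneg (g 0 0), abs_nonneg (g 0 1), abs_nonneg (g 1 0), abs_nonneg (g 1 1)]

lemma enorm2_nonneg (v : Fin 2 → ℝ) : 0 ≤ enorm2 v := Real.sqrt_nonneg _

lemma abs_apply_le_enorm2 (v : Fin 2 → ℝ) (i : Fin 2) : |v i| ≤ enorm2 v := by
  refine Real.abs_le_sqrt ?_
  fin_cases i
  · exact le_add_of_nonneg_right (sq_nonneg (v 1))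
  · exact le_add_of_nonneg_left (sq_nonneg (v 0))

lemma enorm2_le_abs_add_abs (v : Fin 2 → ℝ) : enorm2 v ≤ |v 0| + |v 1| := by
  refine Real.sqrt_le_iff.2 ⟨by positivity, ?_⟩
  nlinarith [abs_nonneg (v 0), abs_nonneg (v 1), sq_abs (v 0), sq_abs (v 1)]

lemma abs_cross_le_enorm2_mul (v w : Fin 2 → ℝ) :
    |v 0 * w 1 - v 1 * w 0| ≤ enorm2 v * enorm2 w := by
  rw [enorm2, enorm2, ← Real.sqrt_mul (by positivity)]
  refine Real.abs_le_sqrt ?_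
  nlinarith [sq_nonneg (v 0 * w 0 + v 1 * w 1)]

lemma SL2_mulVec_apply (g : SL2) (v : Fin 2 → ℝ) (i : Fin 2) :
    (g : Matrix (Fin 2) (Fin 2) ℝ).mulVec v i = g i 0 * v 0 + g i 1 * v 1 := by
  simp [Matrix.mulVec, dotProduct, Fin.sum_univ_two]

lemma enorm2_le_entrySum_mul (g : SL2) (v : Fin 2 → ℝ) :
    enorm2 v ≤ entrySum g * enorm2 ((g : Matrix (Fin 2) (Fin 2) ℝ).mulVec v) := by
  have hd := SL2_det_eq g
  set w := (g : Matrix (Fin 2) (Fin 2) ℝ).mulVec v with hw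
  have hw0 : w 0 = g 0 0 * v 0 + g 0 1 * v 1 := SL2_mulVec_apply g v 0
  have hw1 : w 1 = g 1 0 * v 0 + g 1 1 * v 1 := SL2_mulVec_apply g v 1
  have h0 : v 0 = g 1 1 * w 0 - g 0 1 * w 1 := by
    rw [hw0, hw1]; linear_combination (-v 0) * hd
  have h1 : v 1 = g 0 0 * w 1 - g 1 0 * w 0 := by
    rw [hw0, hw1]; linear_combination (-v 1) * hd
  have hk : ∀ a b : ℝ, |a * w 0 - b * w 1| ≤ (|a| + |b|) * enorm2 w := fun a b => by
    refine (abs_sub _ _).trans ?_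
    rw [abs_mul, abs_mul, add_mul]
    gcongr <;> exact abs_apply_le_enorm2 w _
  have h0' := hk (g 1 1) (g 0 1)
  have h1' := hk (g 1 0) (g 0 0)
  rw [← h0] at h0'
  rw [abs_sub_comm, ← h1] at h1'
  refine (enorm2_le_abs_add_abs v).trans ((add_le_add h0' h1').trans_eq ?_)
  unfold entrySum
  ring

lemma one_le_enorm2_intCast {v : Fin 2 → ℤ} (hv : v ≠ 0) :
    1 ≤ enorm2 fun i => (v i : ℝ) := by
  obtain ⟨i, hi⟩ := Function.ne_iff.1 hv
  refine le_trans ?_ (abs_apply_le_enorm2 _ i)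
  exact_mod_cast Int.one_le_abs hi

lemma sys_set_nonempty (g : SL2) : {x : ℝ | ∃ v : Fin 2 → ℤ, v ≠ 0 ∧
    x = enorm2 ((g : Matrix (Fin 2) (Fin 2) ℝ).mulVec (fun i => (v i : ℝ)))}.Nonempty :=
  ⟨_, 1, one_ne_zero, rfl⟩

lemma sys_le (g : SL2) {v : Fin 2 → ℤ} (hv : v ≠ 0) :
    sys g ≤ enorm2 ((g : Matrix (Fin 2) (Fin 2) ℝ).mulVec (fun i => (v i : ℝ))) := by
  refine csInf_le ⟨0, ?_⟩ ⟨v, hv, rfl⟩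
  rintro _ ⟨w, _, rfl⟩
  exact enorm2_nonneg _

lemma sys_pos (g : SL2) : 0 < sys g := by
  have hN := zero_lt_one.trans_le (one_le_entrySum g)
  refine (inv_pos.2 hN).trans_le (le_csInf (sys_set_nonempty g) ?_)
  rintro _ ⟨w, hw, rfl⟩
  rw [inv_le_iff_one_le_mul₀' hN]
  exact (one_le_enorm2_intCast hw).trans (enorm2_le_entrySum_mul g _)

/-- A nearly shortest vector controls the systole after applying any matrix. -/
lemma exists_vector_sys_rpow_le (g : SL2) : ∃ v : Fin 2 → ℝ, sys g ≤ enorm2 v ∧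
    ∀ (h : SL2) (c : ℝ), 0 ≤ c → sys (h * g) ^ (-c) ≤
      2 ^ c * (entrySum h ^ c + enorm2 ((h : Matrix (Fin 2) (Fin 2) ℝ).mulVec v) ^ (-c)) := by
  have hs := sys_pos g
  obtain ⟨_, ⟨z, hz, rfl⟩, hzlt⟩ := exists_lt_of_csInf_lt (sys_set_nonempty g)
    (show sInf _ < 2 * sys g by change sys g < 2 * sys g; linarith)
  set v := (g : Matrix (Fin 2) (Fin 2) ℝ).mulVec (fun i => (z i : ℝ)) with hv
  refine ⟨v, sys_le g hz, fun h c hc => ?_⟩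
  have hN := zero_lt_one.trans_le (one_le_entrySum h)
  set E := enorm2 ((h : Matrix (Fin 2) (Fin 2) ℝ).mulVec v) with hE
  have hvp : 0 < enorm2 v := hs.trans_le (sys_le g hz)
  have hEp : 0 < E := by
    have := enorm2_le_entrySum_mul h v
    rw [← hE] at this
    exact pos_of_mul_pos_right (hvp.trans_le this) hN.le
  have hmin : 0 < min (entrySum h)⁻¹ E := lt_min (inv_pos.2 hN) hEp
  have hlow : 2⁻¹ * min (entrySum h)⁻¹ E ≤ sys (h * g) := by
    refine le_csInf (sys_set_nonempty _) ?_
    rintro _ ⟨w, hw, rfl⟩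
    rw [Matrix.SpecialLinearGroup.coe_mul, ← Matrix.mulVec_mulVec]
    set y := (g : Matrix (Fin 2) (Fin 2) ℝ).mulVec (fun i => (w i : ℝ)) with hy
    have hys : sys g ≤ enorm2 y := sys_le g hw
    have hcross : v 0 * y 1 - v 1 * y 0 = ((z 0 * w 1 - z 1 * w 0 : ℤ) : ℝ) := by
      have hd := SL2_det_eq g
      simp only [hv, hy, SL2_mulVec_apply]
      push_cast
      linear_combination ((z 0 : ℝ) * w 1 - z 1 * w 0) * hd
    by_cases hdet : z 0 * w 1 - z 1 * w 0 = 0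
    · have hpar : ∃ q : ℝ, y = q • v := by
        rw [hdet, Int.cast_zero] at hcross
        have hsq : v 0 ^ 2 + v 1 ^ 2 ≠ 0 := by
          intro h0
          rw [enorm2, h0, Real.sqrt_zero] at hvp
          exact lt_irrefl _ hvp
        refine ⟨(v 0 * y 0 + v 1 * y 1) / (v 0 ^ 2 + v 1 ^ 2), ?_⟩
        ext i
        fin_cases i
        · simp only [Fin.zero_eta, Pi.smul_apply, smul_eq_mul]
          field_simp
          linear_combination (-v 1) * hcross
        · simp only [Fin.mk_one, Pi.smul_apply, smul_eq_mul]
          field_simp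
          linear_combination v 0 * hcross
      obtain ⟨q, hq⟩ := hpar
      have hsmul : ∀ x : Fin 2 → ℝ, enorm2 (q • x) = |q| * enorm2 x := fun x => by
        simp only [enorm2, Pi.smul_apply, smul_eq_mul, mul_pow]
        rw [← mul_add, Real.sqrt_mul (sq_nonneg q), Real.sqrt_sq_eq_abs]
      rw [hq, hsmul] at hys
      have hq2 : 2⁻¹ ≤ |q| := by
        by_contra! hlt
        nlinarith
      rw [hq, Matrix.mulVec_smul, hsmul]
      exact mul_le_mul hq2 (min_le_right _ _) hmin.le (abs_nonneg q)
    · have h1 : (1 : ℝ) ≤ enorm2 v * enorm2 y := by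
        refine le_trans ?_ (abs_cross_le_enorm2_mul v y)
        rw [hcross]
        exact_mod_cast Int.one_le_abs hdet
      have h2 : 2⁻¹ ≤ enorm2 y := by
        by_contra! hlt
        nlinarith
      have h3 := enorm2_le_entrySum_mul h y
      calc 2⁻¹ * min (entrySum h)⁻¹ E ≤ 2⁻¹ * (entrySum h)⁻¹ := by
            gcongr; exact min_le_left _ _
        _ ≤ (entrySum h)⁻¹ * enorm2 y := by rw [mul_comm]; gcongr
        _ ≤ _ := by rw [inv_mul_le_iff₀ hN]; exact h3
  have hE0 := Real.rpow_nonneg hEp.le (-c)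
  have hN0 := Real.rpow_nonneg hN.le c
  calc sys (h * g) ^ (-c) ≤ (2⁻¹ * min (entrySum h)⁻¹ E) ^ (-c) :=
        Real.rpow_le_rpow_of_nonpos (by positivity) hlow (neg_nonpos.2 hc)
    _ = 2 ^ c * min (entrySum h)⁻¹ E ^ (-c) := by
        rw [Real.mul_rpow (by norm_num) hmin.le, Real.inv_rpow (by norm_num),
          Real.rpow_neg (by norm_num), inv_inv]
    _ ≤ _ := by
        gcongr
        rcases min_choice (entrySum h)⁻¹ E with h | h <;> rw [h]
        · rw [Real.inv_rpow hN.le, Real.rpow_neg hN.le, inv_inv]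
          linarith
        · linarith

lemma entrySum_toP (φ : AffP) : entrySum (toP φ) =
    (Real.sqrt φ.1.1)⁻¹ + (Real.sqrt φ.1.1)⁻¹ * |φ.1.2| + Real.sqrt φ.1.1 := by
  have h := Real.sqrt_nonneg φ.1.1
  simp [entrySum, toP, abs_mul, abs_of_nonneg h]

lemma measurable_entrySum_toP : Measurable fun φ : AffP => entrySum (toP φ) := by
  simp_rw [entrySum_toP]
  have hs : Measurable fun φ : AffP => Real.sqrt φ.1.1 :=
    Real.continuous_sqrt.measurable.comp (by fun_prop)
  have hb : Measurable fun φ : AffP => |φ.1.2| := by fun_prop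
  exact (hs.inv.add (hs.inv.mul hb)).add hs

lemma rpow_le_rpow_add_rpow_neg {R a ε : ℝ} (hR : 0 < R) (h1 : a ≤ ε) (h2 : -ε ≤ a) :
    R ^ a ≤ R ^ ε + R ^ (-ε) := by
  have hp := Real.rpow_pos_of_pos hR ε
  have hn := Real.rpow_pos_of_pos hR (-ε)
  rcases le_total 1 R with h | h
  · linarith [Real.rpow_le_rpow_of_exponent_le h h1]
  · linarith [Real.rpow_le_rpow_of_exponent_ge hR h h2]

lemma abs_rpow_le_moment {R b u ε : ℝ} (hR : 0 < R) (hu : 0 ≤ u) (huε : u ≤ ε) :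
    |b| ^ u ≤ R ^ ε + R ^ (-ε) + |b| ^ ε := by
  have hp := Real.rpow_pos_of_pos hR ε
  have hn := Real.rpow_pos_of_pos hR (-ε)
  have hb := Real.rpow_nonneg (abs_nonneg b) ε
  rcases le_total 1 |b| with h | h
  · linarith [Real.rpow_le_rpow_of_exponent_le h huε]
  · have h1 := rpow_le_rpow_add_rpow_neg (a := 0) hR (hu.trans huε) (by linarith)
    rw [Real.rpow_zero] at h1
    linarith [Real.rpow_le_one (abs_nonneg b) h hu]

lemma entrySum_toP_rpow_le (φ : AffP) {p ε : ℝ} (hε : 0 < ε) (hp : p ≤ ε / 2) :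
    entrySum (toP φ) ^ p ≤
      3 ^ (ε / 2) * (φ.1.1 ^ ε + φ.1.1 ^ (-ε) + |φ.1.2| ^ ε) := by
  obtain ⟨⟨R, b⟩, hR⟩ := φ
  change 0 < R at hR
  have h1 := one_le_entrySum (toP ⟨(R, b), hR⟩)
  refine (Real.rpow_le_rpow_of_exponent_le h1 hp).trans ?_
  have hm : ∃ m : ℝ, 0 ≤ m ∧ (m = R ∨ m = R⁻¹ ∨ m = |b| ^ (2 : ℕ)) ∧
      R ≤ m ∧ R⁻¹ ≤ m ∧ |b| ^ (2 : ℕ) ≤ m := by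
    refine ⟨max R (max R⁻¹ (|b| ^ (2 : ℕ))), hR.le.trans (le_max_left _ _), ?_,
      le_max_left _ _, (le_max_left _ _).trans (le_max_right _ _),
      (le_max_right _ _).trans (le_max_right _ _)⟩
    rcases max_choice R (max R⁻¹ (|b| ^ (2 : ℕ))) with h | h
    · exact Or.inl h
    · rw [h]
      exact Or.inr (max_choice _ _)
  obtain ⟨m, hm0, hmc, hRm, hRm', hbm⟩ := hm
  have hsum : entrySum (toP ⟨(R, b), hR⟩) ≤ 3 * m := by
    rw [entrySum_toP]
    simp only
    have hs := Real.sqrt_pos.2 hR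
    have hss := Real.sq_sqrt hR.le
    set s := Real.sqrt R
    have hs' := inv_pos.2 hs
    have hss' : s⁻¹ ^ 2 = R⁻¹ := by rw [inv_pow, hss]
    have hi : s * s⁻¹ = 1 := mul_inv_cancel₀ hs.ne'
    set w := s⁻¹
    have hw : w ≤ m := by
      rcases le_total w 1 with h | h <;> nlinarith
    have hs1 : s ≤ m := by
      rcases le_total s 1 with h | h <;> nlinarith
    nlinarith [sq_nonneg (w - |b|)]
  have hp := Real.rpow_pos_of_pos hR ε
  have hn := Real.rpow_pos_of_pos hR (-ε)
  have hb := Real.rpow_nonneg (abs_nonneg b) ε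
  calc entrySum (toP ⟨(R, b), hR⟩) ^ (ε / 2) ≤ (3 * m) ^ (ε / 2) :=
        Real.rpow_le_rpow (by linarith) hsum (by positivity)
    _ = 3 ^ (ε / 2) * m ^ (ε / 2) := Real.mul_rpow (by norm_num) hm0
    _ ≤ _ := by
        gcongr
        simp only
        rcases hmc with h | h | h <;> rw [h]
        · linarith [rpow_le_rpow_add_rpow_neg (a := ε / 2) (ε := ε) hR (by linarith) (by linarith)]
        · rw [Real.inv_rpow hR.le, ← Real.rpow_neg hR.le]
          linarith [rpow_le_rpow_add_rpow_neg (a := -(ε / 2)) (ε := ε) hR (by linarith)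
            (by linarith)]
        · rw [← Real.rpow_natCast, ← Real.rpow_mul (abs_nonneg b)]
          rw [show ((2 : ℕ) : ℝ) * (ε / 2) = ε by push_cast; ring]
          linarith

/-- Outside a small bad event the norm of a vector is multiplied by at least `δ / √r`; on the
bad event it shrinks by at most the entry sum. -/
lemma enorm2_toP_mulVec_rpow_le (φ : AffP) {v : Fin 2 → ℝ} (hv : 0 < enorm2 v) {δ c τ : ℝ}
    (hδ : 0 < δ) (hc : 0 < c) (hτ : 0 < τ) :
    ENNReal.ofReal (enorm2 ((toP φ : Matrix (Fin 2) (Fin 2) ℝ).mulVec v) ^ (-c)) ≤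
      ENNReal.ofReal (enorm2 v ^ (-c)) *
        (ENNReal.ofReal (δ ^ (-c)) * ENNReal.ofReal (φ.1.1 ^ (c / 2)) +
          ENNReal.ofReal τ * ENNReal.ofReal (entrySum (toP φ) ^ (2 * c)) +
          {ψ : AffP | |v 0 + ψ.1.2 * v 1| < δ * (|v 0| + |v 1|)}.indicator
            (fun _ => ENNReal.ofReal τ⁻¹) φ) := by
  have hR := φ.2
  have hs := Real.sqrt_pos.2 φ.2
  have hN := zero_lt_one.trans_le (one_le_entrySum (toP φ))
  set E := enorm2 ((toP φ : Matrix (Fin 2) (Fin 2) ℝ).mulVec v) with hE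
  by_cases hφ : |v 0 + φ.1.2 * v 1| < δ * (|v 0| + |v 1|)
  · rw [Set.indicator_of_mem (by exact hφ)]
    have hle : (entrySum (toP φ))⁻¹ * enorm2 v ≤ E := by
      rw [inv_mul_le_iff₀ hN]
      exact enorm2_le_entrySum_mul _ v
    have h1 : E ^ (-c) ≤ enorm2 v ^ (-c) * entrySum (toP φ) ^ c := by
      refine (Real.rpow_le_rpow_of_nonpos (by positivity) hle (neg_nonpos.2 hc.le)).trans_eq ?_
      rw [Real.mul_rpow (by positivity) hv.le, Real.inv_rpow hN.le, Real.rpow_neg hN.le, inv_inv,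
        mul_comm]
    have h2 : entrySum (toP φ) ^ c ≤ τ * entrySum (toP φ) ^ (2 * c) + τ⁻¹ := by
      rw [mul_comm 2 c, Real.rpow_mul hN.le, Real.rpow_two]
      set a := entrySum (toP φ) ^ c
      have ha : 0 ≤ a := Real.rpow_nonneg hN.le c
      rw [← sub_nonneg, show τ * a ^ 2 + τ⁻¹ - a = τ * (a - τ⁻¹) ^ 2 + a by field_simp; ring]
      positivity
    calc ENNReal.ofReal (E ^ (-c))
        ≤ ENNReal.ofReal (enorm2 v ^ (-c) * (τ * entrySum (toP φ) ^ (2 * c) + τ⁻¹)) :=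
          ENNReal.ofReal_le_ofReal (h1.trans (by gcongr))
      _ = ENNReal.ofReal (enorm2 v ^ (-c)) *
          (ENNReal.ofReal τ * ENNReal.ofReal (entrySum (toP φ) ^ (2 * c)) +
            ENNReal.ofReal τ⁻¹) := by
          rw [ENNReal.ofReal_mul (by positivity), ENNReal.ofReal_add (by positivity)
            (by positivity), ENNReal.ofReal_mul hτ.le]
      _ ≤ _ := by
          gcongr
          exact le_add_self
  · push Not at hφ
    have h0 : (toP φ : Matrix (Fin 2) (Fin 2) ℝ).mulVec v 0 =
        (Real.sqrt φ.1.1)⁻¹ * (v 0 + φ.1.2 * v 1) := by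
      rw [SL2_mulVec_apply]
      simp [toP]
      ring
    have hle : (Real.sqrt φ.1.1)⁻¹ * (δ * enorm2 v) ≤ E := by
      refine le_trans ?_ (abs_apply_le_enorm2 _ 0)
      rw [h0, abs_mul, abs_of_pos (inv_pos.2 hs)]
      gcongr
      exact le_trans (by gcongr; exact enorm2_le_abs_add_abs v) hφ
    have h1 : E ^ (-c) ≤ enorm2 v ^ (-c) * (δ ^ (-c) * φ.1.1 ^ (c / 2)) := by
      refine (Real.rpow_le_rpow_of_nonpos (by positivity) hle (neg_nonpos.2 hc.le)).trans_eq ?_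
      rw [Real.mul_rpow (by positivity) (by positivity), Real.mul_rpow hδ.le hv.le,
        Real.inv_rpow hs.le, Real.rpow_neg hs.le, inv_inv, Real.sqrt_eq_rpow,
        ← Real.rpow_mul hR.le, one_div_mul_eq_div]
      ring
    calc ENNReal.ofReal (E ^ (-c))
        ≤ ENNReal.ofReal (enorm2 v ^ (-c) * (δ ^ (-c) * φ.1.1 ^ (c / 2))) :=
          ENNReal.ofReal_le_ofReal h1
      _ = ENNReal.ofReal (enorm2 v ^ (-c)) *
          (ENNReal.ofReal (δ ^ (-c)) * ENNReal.ofReal (φ.1.1 ^ (c / 2))) := by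
          rw [ENNReal.ofReal_mul (by positivity), ENNReal.ofReal_mul (by positivity)]
      _ ≤ _ := by
          rw [add_assoc]
          gcongr
          exact le_self_add

lemma lintegral_sys_rpow_le (P : Measure AffP) [IsProbabilityMeasure P]
    {δ c τ ρ β κ : ℝ} (hδ : 0 < δ) (hc : 0 < c) (hτ : 0 < τ) (hρ : 0 < ρ) (hβ : 0 < β)
    (hκ : τ * β = κ)
    (hP1 : ∫⁻ φ : AffP, ENNReal.ofReal (φ.1.1 ^ (c / 2)) ∂P ≤ ENNReal.ofReal ρ)
    (hP2 : ∫⁻ φ : AffP, ENNReal.ofReal (entrySum (toP φ) ^ (2 * c)) ∂P ≤ ENNReal.ofReal β)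
    (hP3 : ∀ X Y : ℝ, P {φ | |X + φ.1.2 * Y| < δ * (|X| + |Y|)} ≤ ENNReal.ofReal (κ * τ))
    (g : SL2) :
    ∫⁻ h, ENNReal.ofReal (sys (h * g) ^ (-c)) ∂(Measure.map toP P) ≤
      ENNReal.ofReal (2 ^ c * (δ ^ (-c) * ρ + 2 * κ) * sys g ^ (-c) + 2 ^ c * β) := by
  have hκ0 : 0 < κ := hκ ▸ mul_pos hτ hβ
  obtain ⟨v, hsv, hv⟩ := exists_vector_sys_rpow_le g
  have hs := sys_pos g
  have hvp := hs.trans_le hsv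
  set S : Set AffP := {φ | |v 0 + φ.1.2 * v 1| < δ * (|v 0| + |v 1|)} with hS
  have hSm : MeasurableSet S := measurableSet_lt (by fun_prop) measurable_const
  have hm1 : Measurable fun φ : AffP => ENNReal.ofReal (φ.1.1 ^ (c / 2)) := by fun_prop
  have hm2 : Measurable fun φ : AffP => ENNReal.ofReal (entrySum (toP φ) ^ (2 * c)) :=
    (measurable_entrySum_toP.pow_const _).ennreal_ofReal
  have hm2' : Measurable fun φ : AffP => ENNReal.ofReal (entrySum (toP φ) ^ c) :=
    (measurable_entrySum_toP.pow_const _).ennreal_ofReal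
  have hvec : ∫⁻ φ, ENNReal.ofReal
      (enorm2 ((toP φ : Matrix (Fin 2) (Fin 2) ℝ).mulVec v) ^ (-c)) ∂P ≤
        ENNReal.ofReal (sys g ^ (-c) * (δ ^ (-c) * ρ + 2 * κ)) := by
    refine (lintegral_mono fun φ => enorm2_toP_mulVec_rpow_le φ hvp hδ hc hτ).trans ?_
    rw [lintegral_const_mul' _ _ ENNReal.ofReal_ne_top,
      lintegral_add_right _ (measurable_const.indicator hSm),
      lintegral_add_left (hm1.const_mul _), lintegral_const_mul _ hm1,
      lintegral_const_mul _ hm2, lintegral_indicator_const hSm,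
      ENNReal.ofReal_mul (by positivity)]
    have h1 : ENNReal.ofReal (enorm2 v ^ (-c)) ≤ ENNReal.ofReal (sys g ^ (-c)) :=
      ENNReal.ofReal_le_ofReal (Real.rpow_le_rpow_of_nonpos hs hsv (neg_nonpos.2 hc.le))
    refine mul_le_mul' h1 ?_
    calc _ ≤ ENNReal.ofReal (δ ^ (-c)) * ENNReal.ofReal ρ +
          ENNReal.ofReal τ * ENNReal.ofReal β +
          ENNReal.ofReal τ⁻¹ * ENNReal.ofReal (κ * τ) := by
          gcongr
          exact hP3 _ _
      _ = ENNReal.ofReal (δ ^ (-c) * ρ + 2 * κ) := by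
          rw [← ENNReal.ofReal_mul (by positivity), ← ENNReal.ofReal_mul (by positivity),
            ← ENNReal.ofReal_mul (by positivity), ← ENNReal.ofReal_add (by positivity)
            (by positivity), ← ENNReal.ofReal_add (by positivity) (by positivity), hκ]
          congr 1
          field_simp
          ring
  have hent : ∫⁻ φ, ENNReal.ofReal (entrySum (toP φ) ^ c) ∂P ≤ ENNReal.ofReal β := by
    refine le_trans (lintegral_mono fun φ => ENNReal.ofReal_le_ofReal ?_) hP2
    exact Real.rpow_le_rpow_of_exponent_le (one_le_entrySum _) (by linarith)
  have hN : ∀ φ : AffP, 0 ≤ entrySum (toP φ) ^ c := fun φ =>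
    Real.rpow_nonneg (zero_le_one.trans (one_le_entrySum _)) _
  have hEn : ∀ φ : AffP,
      0 ≤ enorm2 ((toP φ : Matrix (Fin 2) (Fin 2) ℝ).mulVec v) ^ (-c) := fun φ =>
    Real.rpow_nonneg (enorm2_nonneg _) _
  calc ∫⁻ h, ENNReal.ofReal (sys (h * g) ^ (-c)) ∂(Measure.map toP P)
      ≤ ∫⁻ φ, ENNReal.ofReal (sys (toP φ * g) ^ (-c)) ∂P := lintegral_map_le _ _
    _ ≤ ∫⁻ φ, ENNReal.ofReal (2 ^ c) * (ENNReal.ofReal (entrySum (toP φ) ^ c) +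
          ENNReal.ofReal (enorm2 ((toP φ : Matrix (Fin 2) (Fin 2) ℝ).mulVec v) ^ (-c))) ∂P := by
        refine lintegral_mono fun φ => ?_
        rw [← ENNReal.ofReal_add (hN φ) (hEn φ), ← ENNReal.ofReal_mul (by positivity)]
        exact ENNReal.ofReal_le_ofReal (hv (toP φ) c hc.le)
    _ ≤ ENNReal.ofReal (2 ^ c) * (ENNReal.ofReal β +
          ENNReal.ofReal (sys g ^ (-c) * (δ ^ (-c) * ρ + 2 * κ))) := by
        rw [lintegral_const_mul' _ _ ENNReal.ofReal_ne_top, lintegral_add_left hm2']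
        gcongr
    _ = _ := by
        rw [← ENNReal.ofReal_add (by positivity) (by positivity),
          ← ENNReal.ofReal_mul (by positivity)]
        congr 1
        ring

/-- Contraction estimate: there are `k ≥ 1`, `c, r ∈ (0,1)` and `C > 0` with
`∫ sys(hg)^{-c} dμ^{*k}(h) ≤ r · sys(g)^{-c} + C` for every `g`. -/
theorem sys_contraction
    (lam : Measure AffP) [IsProbabilityMeasure lam]
    (hmom : ∃ ε : ℝ, 0 < ε ∧
      ∫⁻ φ : AffP, ENNReal.ofReal (φ.1.1 ^ ε + φ.1.1 ^ (-ε) + |φ.1.2| ^ ε) ∂lam < ⊤)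
    (hnofix : ¬ ∃ t : ℝ, ∀ φ ∈ msupport lam, φ.1.1 * t + φ.1.2 = t)
    (hcontr : ∫ φ : AffP, Real.log φ.1.1 ∂lam < 0) :
    ∃ k : ℕ, 1 ≤ k ∧ ∃ c r C : ℝ, 0 < c ∧ c < 1 ∧ 0 < r ∧ r < 1 ∧ 0 < C ∧
      ∀ g : SL2,
        ∫⁻ h, ENNReal.ofReal (sys (h * g) ^ (-c)) ∂(convN (Measure.map toP lam) k) ≤
          ENNReal.ofReal (r * sys g ^ (-c) + C) := by
  obtain ⟨ε, hε, hM⟩ := hmom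
  have hrpow : ∀ (φ : AffP) (a : ℝ), 0 < φ.1.1 ^ a := fun φ a => Real.rpow_pos_of_pos φ.2 a
  have hbpow : ∀ (φ : AffP) (a : ℝ), 0 ≤ |φ.1.2| ^ a := fun φ a =>
    Real.rpow_nonneg (abs_nonneg _) a
  have hint : Integrable (fun φ : AffP => φ.1.1 ^ ε + φ.1.1 ^ (-ε) + |φ.1.2| ^ ε) lam := by
    refine (lintegral_ofReal_ne_top_iff_integrable ?_ ?_).1 hM.ne
    · exact (by fun_prop : Measurable fun φ : AffP =>
        φ.1.1 ^ ε + φ.1.1 ^ (-ε) + |φ.1.2| ^ ε).aestronglyMeasurable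
    · exact ae_of_all _ fun φ => add_nonneg (add_pos (hrpow φ _) (hrpow φ _)).le (hbpow φ _)
  have hp : Integrable (fun φ : AffP => φ.1.1 ^ ε) lam := by
    refine hint.mono' (by fun_prop : Measurable fun φ : AffP =>
      φ.1.1 ^ ε).aestronglyMeasurable (ae_of_all _ fun φ => ?_)
    rw [Real.norm_of_nonneg (hrpow φ ε).le]
    linarith [hrpow φ (-ε), hbpow φ ε]
  have hn : Integrable (fun φ : AffP => φ.1.1 ^ (-ε)) lam := by
    refine hint.mono' (by fun_prop : Measurable fun φ : AffP =>
      φ.1.1 ^ (-ε)).aestronglyMeasurable (ae_of_all _ fun φ => ?_)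
    rw [Real.norm_of_nonneg (hrpow φ (-ε)).le]
    linarith [hrpow φ ε, hbpow φ ε]
  obtain ⟨u, hu, hulow, huε, hA⟩ := exists_small_exponent lam hε hp hn hcontr
    (u₀ := min 1 (ε / 8)) (by positivity)
  have hu1 : u < 1 := hulow.trans_le (min_le_left _ _)
  have hu8 : u < ε / 8 := hulow.trans_le (min_le_right _ _)
  have hb : ∫⁻ φ : AffP, ENNReal.ofReal (|φ.1.2| ^ u) ∂lam < ⊤ :=
    (lintegral_mono fun φ => ENNReal.ofReal_le_ofReal
      (abs_rpow_le_moment φ.2 hu.le huε.le)).trans_lt hM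
  set G₁ : AffP → ENNReal := fun φ => ENNReal.ofReal (φ.1.1 ^ u) with hG₁
  set G₂ : AffP → ENNReal := fun φ => ENNReal.ofReal (entrySum (toP φ) ^ (4 * u)) with hG₂
  have hG₁m : Measurable G₁ := by fun_prop
  have hG₂m : Measurable G₂ := (measurable_entrySum_toP.pow_const _).ennreal_ofReal
  have hN : ∀ φ, 0 ≤ entrySum (toP φ) := fun φ => zero_le_one.trans (one_le_entrySum _)
  have hG₁mul : ∀ φ ψ : AffP, G₁ (φ.comp ψ) ≤ G₁ φ * G₁ ψ := fun φ ψ => by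
    simp only [hG₁]
    rw [← ENNReal.ofReal_mul (hrpow φ u).le, ← Real.mul_rpow φ.2.le ψ.2.le, mul_comm]
    rfl
  have hG₂mul : ∀ φ ψ : AffP, G₂ (φ.comp ψ) ≤ G₂ φ * G₂ ψ := fun φ ψ => by
    simp only [hG₂]
    rw [← ENNReal.ofReal_mul (Real.rpow_nonneg (hN φ) _), ← Real.mul_rpow (hN φ) (hN ψ), toP_comp]
    exact ENNReal.ofReal_le_ofReal (Real.rpow_le_rpow (zero_le_one.trans (one_le_entrySum _))
      (entrySum_mul_le _ _) (by positivity))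
  have hG₂one : 1 ≤ G₂ AffP.id := by
    simp only [hG₂, ENNReal.one_le_ofReal]
    exact Real.one_le_rpow (one_le_entrySum _) (by positivity)
  have hB : (∫⁻ φ, G₂ φ ∂lam) * G₂ AffP.id < ⊤ := by
    refine ENNReal.mul_lt_top ?_ ENNReal.ofReal_lt_top
    refine (lintegral_mono fun φ => ENNReal.ofReal_le_ofReal
      (entrySum_toP_rpow_le φ hε (by linarith : 4 * u ≤ ε / 2))).trans_lt ?_
    simp_rw [ENNReal.ofReal_mul (by positivity : (0 : ℝ) ≤ 3 ^ (ε / 2))]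
    rw [lintegral_const_mul' _ _ ENNReal.ofReal_ne_top]
    exact ENNReal.mul_lt_top ENNReal.ofReal_lt_top hM
  obtain ⟨ρ, hρA, hρ1⟩ := exists_between hA
  lift ρ to NNReal using hρ1.ne_top
  have hρ0 : (0 : ℝ) < ρ := by exact_mod_cast pos_of_gt hρA
  have hρ1' : (ρ : ℝ) < 1 := by exact_mod_cast hρ1
  obtain ⟨β, hβB, hβt⟩ := exists_between hB
  lift β to NNReal using hβt.ne
  have hβ0 : (0 : ℝ) < β := by exact_mod_cast pos_of_gt hβB
  set κ : ℝ := (1 - ρ) / 8 with hκ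
  have hκ0 : 0 < κ := by rw [hκ]; linarith
  set τ : ℝ := κ / β with hτ
  have hτ0 : 0 < τ := by positivity
  obtain ⟨δ, hδ, hev⟩ := exists_affConv_nonconcentration lam hnofix hu hu1.le hA hb
    (η := ENNReal.ofReal (κ * τ)) (by simpa using mul_pos hκ0 hτ0)
  have hc0 : Tendsto (fun k : ℕ => 2 * u / (k : ℝ)) atTop (𝓝 0) :=
    tendsto_const_div_atTop_nhds_zero_nat _
  have hrlim : Tendsto (fun c : ℝ => 2 ^ c * (δ ^ (-c) * ρ + 2 * κ)) (𝓝 0) (𝓝 (ρ + 2 * κ)) := by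
    have hcont : Continuous fun c : ℝ => (2 : ℝ) ^ c * (δ ^ (-c) * ρ + 2 * κ) := by
      have h1 : Continuous fun c : ℝ => (2 : ℝ) ^ c := Real.continuous_const_rpow (by norm_num)
      have h2 : Continuous fun c : ℝ => δ ^ (-c) :=
        (Real.continuous_const_rpow hδ.ne').comp continuous_neg
      fun_prop
    simpa using hcont.tendsto 0
  have hr1 := (hrlim.comp hc0).eventually (gt_mem_nhds (by rw [hκ]; linarith : ρ + 2 * κ < 1))
  have hc1 := hc0.eventually (gt_mem_nhds one_pos)
  obtain ⟨k, hk, hr, hck, hnc⟩ :=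
    ((eventually_ge_atTop 1).and (hr1.and (hc1.and hev))).exists
  have hk0 : (0 : ℝ) < k := by exact_mod_cast hk
  set c := 2 * u / (k : ℝ) with hc
  have hcp : 0 < c := by positivity
  refine ⟨k, hk, c, 2 ^ c * (δ ^ (-c) * ρ + 2 * κ), 2 ^ c * β, hcp, hck, by positivity, hr,
    by positivity, fun g => ?_⟩
  rw [convN_map_toP]
  refine lintegral_sys_rpow_le (affConv lam k) hδ hcp hτ0 hρ0 hβ0 (by rw [hτ]; field_simp)
    ?_ ?_ hnc g
  · have h := lintegral_affConv_root_le lam hG₁m hG₁mul hk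
    have hid : G₁ AffP.id = 1 := by simp [hG₁, AffP.id]
    rw [hid, ENNReal.one_rpow, mul_one] at h
    rw [ENNReal.ofReal_coe_nnreal]
    refine le_trans (le_of_eq (lintegral_congr fun φ => ?_)) (h.trans hρA.le)
    simp only [hG₁]
    rw [ENNReal.ofReal_rpow_of_nonneg (hrpow φ u).le (by positivity), ← Real.rpow_mul φ.2.le]
    congr 2
    rw [hc]; field_simp
  · have h := lintegral_affConv_root_le lam hG₂m hG₂mul hk
    have hid : G₂ AffP.id ^ (k : ℝ)⁻¹ ≤ G₂ AffP.id := by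
      conv_rhs => rw [← ENNReal.rpow_one (G₂ AffP.id)]
      exact ENNReal.rpow_le_rpow_of_exponent_le hG₂one
        (inv_le_one_of_one_le₀ (by exact_mod_cast hk))
    rw [ENNReal.ofReal_coe_nnreal]
    refine le_trans (le_of_eq (lintegral_congr fun φ => ?_))
      (h.trans ((by gcongr : _ ≤ _).trans hβB.le))
    simp only [hG₂]
    rw [ENNReal.ofReal_rpow_of_nonneg (Real.rpow_nonneg (hN φ) _) (by positivity),
      ← Real.rpow_mul (hN φ)]
    congr 2
    rw [hc]; field_simp; ring
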